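/- If X is a sofic-Dyck shift over a pushdown alphabet A, Y is a subshift of B^ℤ for a pushdown alphabet B, and there is a proper conjugacy from X onto Y, then Y is a sofic-Dyck shift over B. -/

import Mathlib

namespace SD

/-- The three kinds of letters of a pushdown alphabet. -/
inductive LetterKind : Type
  | call
  | ret
  | intern
  deriving DecidableEq

/-- A pushdown alphabet structure on `A`: a partition of the letters into
call letters, return letters and internal letters. -/
structure PushdownAlphabet (A : Type*) where
  kind : A → LetterKind

/-- Number of call letters of a word. -/
def callCount {A : Type*} (P : PushdownAlphabet A) (u : List A) : ℕ :=
  u.countP (fun a => decide (P.kind a = LetterKind.call))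

/-- Number of return letters of a word. -/
def retCount {A : Type*} (P : PushdownAlphabet A) (u : List A) : ℕ :=
  u.countP (fun a => decide (P.kind a = LetterKind.ret))

/-- A word is matched-return if every prefix has at least as many call letters
as return letters. -/
def MatchedReturn {A : Type*} (P : PushdownAlphabet A) (u : List A) : Prop :=
  ∀ v w : List A, u = v ++ w → retCount P v ≤ callCount P v

/-- A word is matched-call if every suffix has at least as many return letters
as call letters. -/
def MatchedCall {A : Type*} (P : PushdownAlphabet A) (u : List A) : Prop :=
  ∀ v w : List A, u = v ++ w → callCount P w ≤ retCount P w

/-- A Dyck word is a word which is both matched-return and matched-call. -/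
def IsDyck {A : Type*} (P : PushdownAlphabet A) (u : List A) : Prop :=
  MatchedReturn P u ∧ MatchedCall P u

/-- The factor of length `n` of a bi-infinite sequence starting at position `i`. -/
def factorAt {A : Type*} (x : ℤ → A) (i : ℤ) (n : ℕ) : List A :=
  (List.range n).map (fun k => x (i + (k : ℤ)))

/-- `w` is a (finite) factor of the bi-infinite sequence `x`. -/
def IsFactorOf {A : Type*} (w : List A) (x : ℤ → A) : Prop :=
  ∃ i : ℤ, w = factorAt x i w.length

/-- A Dyck automaton over alphabet `A` with states `Q`: a labeled graph together
with a set of matched pairs of edges. -/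
structure DyckAutomaton (A : Type*) (Q : Type*) where
  edges : Set (Q × A × Q)
  matched : Set ((Q × A × Q) × (Q × A × Q))

/-- Well-formedness of a Dyck automaton: matched pairs consist of edges of the
automaton, a call edge followed by a return edge. -/
def DyckAutomaton.WellFormed {A Q : Type*} (P : PushdownAlphabet A)
    (𝒜 : DyckAutomaton A Q) : Prop :=
  ∀ e f : Q × A × Q, (e, f) ∈ 𝒜.matched →
    e ∈ 𝒜.edges ∧ f ∈ 𝒜.edges ∧
    P.kind e.2.1 = LetterKind.call ∧ P.kind f.2.1 = LetterKind.ret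

/-- The label of a finite path. -/
def pathLabel {A Q : Type*} (π : List (Q × A × Q)) : List A :=
  π.map (fun e => e.2.1)

/-- A finite path of the underlying graph: a sequence of consecutive edges. -/
def IsPath {A Q : Type*} (𝒜 : DyckAutomaton A Q) (π : List (Q × A × Q)) : Prop :=
  (∀ e ∈ π, e ∈ 𝒜.edges) ∧ π.Chain' (fun e f => e.2.2 = f.1)

/-- A finite path is admissible if for any factor `e · π₁ · f` of it with `e` a call
edge, `f` a return edge and the label of `π₁` a Dyck word, `(e,f)` is a matched pair. -/
def IsAdmissible {A Q : Type*} (P : PushdownAlphabet A) (𝒜 : DyckAutomaton A Q)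
    (π : List (Q × A × Q)) : Prop :=
  IsPath 𝒜 π ∧
  ∀ (π₀ : List (Q × A × Q)) (e : Q × A × Q) (π₁ : List (Q × A × Q)) (f : Q × A × Q)
    (π₂ : List (Q × A × Q)), π = π₀ ++ e :: π₁ ++ f :: π₂ →
    P.kind e.2.1 = LetterKind.call → P.kind f.2.1 = LetterKind.ret →
    IsDyck P (pathLabel π₁) → (e, f) ∈ 𝒜.matched

/-- The finite factor of a bi-infinite path starting at index `i`, of length `n`. -/
def pathSeg {A Q : Type*} (π : ℤ → Q × A × Q) (i : ℤ) (n : ℕ) : List (Q × A × Q) :=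
  (List.range n).map (fun k => π (i + (k : ℤ)))

/-- A bi-infinite path is admissible if it is a bi-infinite path of the graph all of
whose finite factors are admissible. -/
def BiAdmissible {A Q : Type*} (P : PushdownAlphabet A) (𝒜 : DyckAutomaton A Q)
    (π : ℤ → Q × A × Q) : Prop :=
  (∀ i : ℤ, π i ∈ 𝒜.edges) ∧ (∀ i : ℤ, (π i).2.2 = (π (i + 1)).1) ∧
  ∀ (i : ℤ) (n : ℕ), IsAdmissible P 𝒜 (pathSeg π i n)

/-- The sofic-Dyck shift presented by a Dyck automaton: the set of labels of
bi-infinite admissible paths. -/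
def presents {A Q : Type*} (P : PushdownAlphabet A) (𝒜 : DyckAutomaton A Q) :
    Set (ℤ → A) :=
  { x | ∃ π : ℤ → Q × A × Q, BiAdmissible P 𝒜 π ∧ ∀ i : ℤ, (π i).2.1 = x i }

/-- A sofic-Dyck shift over `A`: a set presented by some (finite, well-formed)
Dyck automaton. -/
def IsSoficDyck {A : Type*} (P : PushdownAlphabet A) (X : Set (ℤ → A)) : Prop :=
  ∃ (N : ℕ) (𝒜 : DyckAutomaton A (Fin N)), 𝒜.WellFormed P ∧ X = presents P 𝒜

/-- A finite path goes from `p` to `q` (an empty path goes from `p` to `p`). -/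
def GoesFromTo {A Q : Type*} (π : List (Q × A × Q)) (p q : Q) : Prop :=
  (∀ e ∈ π.head?, e.1 = p) ∧ (∀ e ∈ π.getLast?, e.2.2 = q) ∧ (π = [] → p = q)

/-- A finite path starts at state `p`. -/
def StartsAt {A Q : Type*} (π : List (Q × A × Q)) (p : Q) : Prop :=
  ∀ e ∈ π.head?, e.1 = p

/-- `Φ` is an `(m,n)`-block map on `X` for some `m, n`: there is a block function `φ`
with `Φ(x)_i = φ(x_{i-m} ⋯ x_{i+n})` for all `x ∈ X` and `i ∈ ℤ`. -/
def IsBlockMapOn {A B : Type*} (X : Set (ℤ → A)) (Φ : (ℤ → A) → ℤ → B) : Prop :=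
  ∃ (m n : ℕ) (φ : List A → B),
    ∀ x ∈ X, ∀ i : ℤ, Φ x i = φ (factorAt x (i - (m : ℤ)) (m + n + 1))

/-- A map is proper on `X` if it sends call (resp. return, internal) letters to
call (resp. return, internal) letters. -/
def IsProperOn {A B : Type*} (P : PushdownAlphabet A) (PB : PushdownAlphabet B)
    (X : Set (ℤ → A)) (Φ : (ℤ → A) → ℤ → B) : Prop :=
  ∀ x ∈ X, ∀ i : ℤ, PB.kind (Φ x i) = P.kind (x i)

end SD

open SD

namespace SD

section Words

variable {A B : Type*}

theorem factorAt_eq_map (x : ℤ → A) (i : ℤ) (n : ℕ) :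
    factorAt x i n = (List.range n).map fun k : ℕ => x (i + k) := by
  change List.map _ (List.flatMap _ _) = _
  simp only [List.map_flatMap]
  exact List.map_eq_flatMap.symm

@[simp]
theorem length_factorAt (x : ℤ → A) (i : ℤ) (n : ℕ) : (factorAt x i n).length = n := by
  simp [factorAt_eq_map]

theorem factorAt_add (x : ℤ → A) (i : ℤ) (a b : ℕ) :
    factorAt x i (a + b) = factorAt x i a ++ factorAt x (i + a) b := by
  simp [factorAt_eq_map, List.range_add, Function.comp_def, add_assoc]

theorem factorAt_succ (x : ℤ → A) (i : ℤ) (n : ℕ) :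
    factorAt x i (n + 1) = x i :: factorAt x (i + 1) n := by
  rw [add_comm n 1, factorAt_add]
  simp [factorAt_eq_map]

theorem factorAt_eq_append {x : ℤ → A} {i : ℤ} {n : ℕ} {u v : List A}
    (h : factorAt x i n = u ++ v) :
    u = factorAt x i u.length ∧ v = factorAt x (i + u.length) v.length := by
  have hn : n = u.length + v.length := by simpa using congrArg List.length h
  rw [hn, factorAt_add] at h
  obtain ⟨h₁, h₂⟩ := List.append_inj h (by simp)
  exact ⟨h₁.symm, h₂.symm⟩

theorem factorAt_eq_cons {x : ℤ → A} {i : ℤ} {n : ℕ} {a : A} {v : List A}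
    (h : factorAt x i n = a :: v) : a = x i ∧ v = factorAt x (i + 1) v.length := by
  have hn : n = v.length + 1 := by simpa using congrArg List.length h
  rw [hn, factorAt_succ] at h
  simp only [List.cons.injEq] at h
  exact ⟨h.1.symm, h.2.symm⟩

theorem map_factorAt (f : A → B) (x : ℤ → A) (i : ℤ) (n : ℕ) :
    (factorAt x i n).map f = factorAt (fun j => f (x j)) i n := by
  simp [factorAt_eq_map, Function.comp_def]

theorem factorAt_eq_ofFn (x : ℤ → A) (i : ℤ) (n : ℕ) :
    factorAt x i n = List.ofFn fun j : Fin n => x (i + (j : ℕ)) := by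
  apply List.ext_getElem <;> simp [factorAt_eq_map]

theorem isChain_factorAt {R : A → A → Prop} {x : ℤ → A} (h : ∀ i, R (x i) (x (i + 1)))
    (i : ℤ) (n : ℕ) : (factorAt x i n).IsChain R := by
  rw [List.isChain_iff_getElem]
  intro k hk
  simpa [factorAt_eq_map, add_assoc] using h (i + k)

end Words

section Kinds

variable {A B : Type*} {P : PushdownAlphabet A} {PB : PushdownAlphabet B}

theorem callCount_congr {u : List A} {v : List B} (h : u.map P.kind = v.map PB.kind) :
    callCount P u = callCount PB v := by
  simpa [callCount, retCount, List.countP_map, Function.comp_def] using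
    congrArg (List.countP fun k => decide (k = LetterKind.call)) h

theorem retCount_congr {u : List A} {v : List B} (h : u.map P.kind = v.map PB.kind) :
    retCount P u = retCount PB v := by
  simpa [callCount, retCount, List.countP_map, Function.comp_def] using
    congrArg (List.countP fun k => decide (k = LetterKind.ret)) h

/-- Being a Dyck word depends only on the kinds of the letters. -/
theorem IsDyck.congr {u : List A} {v : List B} (h : u.map P.kind = v.map PB.kind)
    (hu : IsDyck P u) : IsDyck PB v := by
  constructor
  · rintro s t rfl
    rw [List.map_append] at h
    obtain ⟨s', t', rfl, hs, -⟩ := List.map_eq_append_iff.1 h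
    rw [← retCount_congr hs, ← callCount_congr hs]
    exact hu.1 s' t' rfl
  · rintro s t rfl
    rw [List.map_append] at h
    obtain ⟨s', t', rfl, -, ht⟩ := List.map_eq_append_iff.1 h
    rw [← retCount_congr ht, ← callCount_congr ht]
    exact hu.2 s' t' rfl

end Kinds

/-- Positional form of admissibility of a bi-infinite path: every call edge is matched with the
return edge closing the Dyck word that follows it. -/
theorem biAdmissible_iff {A Q : Type*} {P : PushdownAlphabet A} {𝒜 : DyckAutomaton A Q}
    {π : ℤ → Q × A × Q} :
    BiAdmissible P 𝒜 π ↔ (∀ i, π i ∈ 𝒜.edges) ∧ (∀ i, (π i).2.2 = (π (i + 1)).1) ∧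
      ∀ (i : ℤ) (l : ℕ), P.kind (π i).2.1 = LetterKind.call →
        P.kind (π (i + 1 + l)).2.1 = LetterKind.ret →
        IsDyck P (factorAt (fun j => (π j).2.1) (i + 1) l) → (π i, π (i + 1 + l)) ∈ 𝒜.matched := by
  refine and_congr_right fun hedge => and_congr_right fun hpath => ⟨fun h i l hc hr hd => ?_,
    fun h i n => ⟨⟨?_, isChain_factorAt (x := π) (R := fun e f : Q × A × Q => e.2.2 = f.1) hpath i n⟩, ?_⟩⟩
  · refine (h i (l + 1 + 1)).2 [] (π i) (factorAt π (i + 1) l) (π (i + 1 + l)) [] ?_ hc hr ?_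
    · change factorAt π i (l + 1 + 1) = _
      rw [factorAt_succ, factorAt_add]
      simp [factorAt_eq_map]
    · rwa [pathLabel, map_factorAt]
  · intro e he
    rw [show pathSeg π i n = factorAt π i n from rfl, factorAt_eq_map] at he
    obtain ⟨k, -, rfl⟩ := List.mem_map.1 he
    exact hedge _
  · intro π₀ e π₁ f π₂ hfac hc hr hd
    replace hfac : factorAt π i n = π₀ ++ (e :: (π₁ ++ f :: π₂)) := by
      rw [← List.cons_append, ← List.append_assoc]
      exact hfac
    obtain ⟨he, h₁⟩ := factorAt_eq_cons (factorAt_eq_append hfac).2.symm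
    obtain ⟨h₂, h₃⟩ := factorAt_eq_append h₁.symm
    obtain ⟨hf, -⟩ := factorAt_eq_cons h₃.symm
    subst he hf
    refine h _ _ hc hr ?_
    rwa [h₂, pathLabel, map_factorAt] at hd

/-- The transitions of the sliding-window automaton of a block map with block function `φ`.
A state `s` encodes, by means of `d`, a window of `m + n + 1` triples of `𝒜`; a transition shifts
the window by one position, and outputs the value of `φ` on the labels of the window of its
source. -/
def IsWindowEdge {A B Q S : Type*} (P : PushdownAlphabet A) (PB : PushdownAlphabet B)
    (𝒜 : DyckAutomaton A Q) (m n : ℕ) (φ : List A → B) (d : S → Fin (m + n + 1) → Q × A × Q)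
    (e : S × B × S) : Prop :=
  e.2.1 = φ (List.ofFn fun j => (d e.1 j).2.1) ∧
  PB.kind e.2.1 = P.kind (d e.1 ⟨m, by omega⟩).2.1 ∧
  d e.1 ⟨m, by omega⟩ ∈ 𝒜.edges ∧
  (d e.1 ⟨m, by omega⟩).2.2 = (d e.2.2 ⟨m, by omega⟩).1 ∧
  ∀ (j : ℕ) (hj : j + 1 < m + n + 1), d e.2.2 ⟨j, by omega⟩ = d e.1 ⟨j + 1, hj⟩

/-- The sliding-window automaton: transitions are those of `IsWindowEdge`, and two of them are
matched when the triples at the center of their windows are. -/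
def windowAutomaton {A B Q S : Type*} (P : PushdownAlphabet A) (PB : PushdownAlphabet B)
    (𝒜 : DyckAutomaton A Q) (m n : ℕ) (φ : List A → B) (d : S → Fin (m + n + 1) → Q × A × Q) :
    DyckAutomaton B S where
  edges := { e | IsWindowEdge P PB 𝒜 m n φ d e }
  matched := { ef | IsWindowEdge P PB 𝒜 m n φ d ef.1 ∧ IsWindowEdge P PB 𝒜 m n φ d ef.2 ∧
    (d ef.1.1 ⟨m, by omega⟩, d ef.2.1 ⟨m, by omega⟩) ∈ 𝒜.matched }

section WindowAutomaton

variable {A B Q S : Type*} {P : PushdownAlphabet A} {PB : PushdownAlphabet B}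
  {𝒜 : DyckAutomaton A Q} {m n : ℕ} {φ : List A → B} {d : S → Fin (m + n + 1) → Q × A × Q}

theorem wellFormed_windowAutomaton (h𝒜 : 𝒜.WellFormed P) :
    (windowAutomaton P PB 𝒜 m n φ d).WellFormed PB := by
  rintro e f ⟨he, hf, hm⟩
  obtain ⟨-, -, hc, hr⟩ := h𝒜 _ _ hm
  exact ⟨he, hf, he.2.1.trans hc, hf.2.1.trans hr⟩

/-- The sliding-window automaton presents the image of the shift presented by `𝒜`. -/
theorem presents_windowAutomaton (hd : Function.Surjective d) {Φ : (ℤ → A) → ℤ → B}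
    (hΦ : ∀ x ∈ presents P 𝒜, ∀ i : ℤ, Φ x i = φ (factorAt x (i - (m : ℤ)) (m + n + 1)))
    (hp : IsProperOn P PB (presents P 𝒜) Φ) :
    presents PB (windowAutomaton P PB 𝒜 m n φ d) = Φ '' presents P 𝒜 := by
  ext y
  constructor
  · rintro ⟨ρ, hρ, hy⟩
    obtain ⟨hedge, hpath, hmatch⟩ := biAdmissible_iff.1 hρ
    have hshift : ∀ (j : ℕ) (hj : j < m + n + 1) (i : ℤ),
        d (ρ i).1 ⟨j, hj⟩ = d (ρ (i + j)).1 ⟨0, by omega⟩ := by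
      intro j
      induction j with
      | zero => simp
      | succ j ih =>
        intro hj i
        rw [← (hedge i).2.2.2.2 j hj, hpath, ih]
        congr 3
        push_cast
        ring
    set π : ℤ → Q × A × Q := fun i => d (ρ i).1 ⟨m, by omega⟩ with hπ
    have hwin : ∀ (i : ℤ) (j : Fin (m + n + 1)), d (ρ i).1 j = π (i - m + (j : ℕ)) := by
      intro i j
      rw [hπ]
      simp only
      rw [hshift j.1 j.2, hshift m]
      congr 3
      ring
    have hkind : ∀ i, P.kind (π i).2.1 = PB.kind (ρ i).2.1 := fun i => (hedge i).2.1.symm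
    have hx : (fun i => (π i).2.1) ∈ presents P 𝒜 := by
      refine ⟨π, biAdmissible_iff.2 ⟨fun i => (hedge i).2.2.1, fun i => ?_, ?_⟩, fun _ => rfl⟩
      · rw [hπ]
        simp only
        rw [← hpath]
        exact (hedge i).2.2.2.1
      · intro i l hc hr hD
        refine (hmatch i l ((hkind _).symm.trans hc) ((hkind _).symm.trans hr)
          (hD.congr ?_)).2.2
        simp only [map_factorAt, hkind]
    refine ⟨_, hx, funext fun i => ?_⟩
    rw [hΦ _ hx, ← hy, (hedge i).1, factorAt_eq_ofFn]
    simp only [hwin]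
  · rintro ⟨x, hx, rfl⟩
    obtain ⟨π, hπ, hlab⟩ := id hx
    obtain ⟨hedge, hpath, hmatch⟩ := biAdmissible_iff.1 hπ
    choose s hs using fun i : ℤ => hd fun j => π (i - m + (j : ℕ))
    have hcenter : ∀ i, d (s i) ⟨m, by omega⟩ = π i := fun i => by simp [hs]
    have hwedge : ∀ i, IsWindowEdge P PB 𝒜 m n φ d (s i, Φ x i, s (i + 1)) := by
      intro i
      refine ⟨?_, ?_, ?_, ?_, fun j hj => ?_⟩
      · simp only [hΦ x hx, factorAt_eq_ofFn, hs, hlab]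
      · simp only [hcenter, hlab, hp x hx]
      · simpa only [hcenter] using hedge i
      · simpa only [hcenter] using hpath i
      · simp only [hs]
        congr 1
        push_cast
        ring
    refine ⟨fun i => (s i, Φ x i, s (i + 1)),
      biAdmissible_iff.2 ⟨hwedge, fun _ => rfl, fun i l hc hr hD => ⟨hwedge _, hwedge _, ?_⟩⟩,
      fun _ => rfl⟩
    simp only [hcenter]
    simp only [hp x hx] at hc hr
    refine hmatch i l (by rwa [hlab]) (by rwa [hlab]) (hD.congr ?_)
    simp only [map_factorAt, hp x hx, hlab]

end WindowAutomaton

/-- The image of a sofic-Dyck shift under a proper block map is a sofic-Dyck shift. -/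
theorem IsSoficDyck.image {A B : Type*} [Finite A] {P : PushdownAlphabet A}
    {PB : PushdownAlphabet B} {X : Set (ℤ → A)} (hX : IsSoficDyck P X) {Φ : (ℤ → A) → ℤ → B}
    (hΦ : IsBlockMapOn X Φ) (hp : IsProperOn P PB X Φ) : IsSoficDyck PB (Φ '' X) := by
  obtain ⟨N, 𝒜, h𝒜, rfl⟩ := hX
  obtain ⟨m, n, φ, hφ⟩ := hΦ
  obtain ⟨M, ⟨ε⟩⟩ := Finite.exists_equiv_fin (Fin (m + n + 1) → Fin N × A × Fin N)
  exact ⟨M, windowAutomaton P PB 𝒜 m n φ ε.symm, wellFormed_windowAutomaton h𝒜,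
    (presents_windowAutomaton ε.symm.surjective hφ hp).symm⟩

end SD

/-- The class of sofic-Dyck shifts is invariant under proper conjugacy. -/
theorem statement_6 {A B : Type*} [Fintype A] [Fintype B]
    [TopologicalSpace B] [DiscreteTopology B]
    (P : PushdownAlphabet A) (PB : PushdownAlphabet B)
    (X : Set (ℤ → A)) (Y : Set (ℤ → B))
    (hX : IsSoficDyck P X)
    (hYinv : (fun y : ℤ → B => fun i : ℤ => y (i + 1)) '' Y = Y) (hYclosed : IsClosed Y)
    (Φ : (ℤ → A) → ℤ → B) (Ψ : (ℤ → B) → ℤ → A)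
    (hΦ : IsBlockMapOn X Φ) (hΦp : IsProperOn P PB X Φ)
    (hΨ : IsBlockMapOn Y Ψ) (hΨp : IsProperOn PB P Y Ψ)
    (him : Φ '' X = Y) (hli : ∀ x ∈ X, Ψ (Φ x) = x) (hri : ∀ y ∈ Y, Φ (Ψ y) = y) :
    IsSoficDyck PB Y := by
  exact him ▸ hX.image hΦ hΦp
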